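/- arXiv:hep-th/0303187 — 9 statements merged into one kernel-verified Lean document; each statement's English description precedes it below -/
import Mathlib

section
/- Let S₁₂ satisfy (unit1) and let R : ℝ → M satisfy the boundary Yang–Baxter equation (rr1). Then the matrix function T(χ) := R(χ)·R(−χ) satisfies both the transmission Yang–Baxter equation (tt1): S₁₂(χ₁,χ₂)T₂(χ₁)S₁₂(χ₂,χ₁)T₂(χ₂) = T₂(χ₂)S₁₂(χ₁,χ₂)T₂(χ₁)S₁₂(χ₂,χ₁) for all χ₁,χ₂, and the transmission–reflection Yang–Baxter equation (tr1): S₁₂(χ₁,χ₂)T₂(χ₁)S₁₂(χ₂,χ₁)R₂(χ₂) = R₂(χ₂)S₁₂(χ₁,−χ₂)T₂(χ₁)S₁₂(−χ₂,χ₁) for all χ₁,χ₂. (First step of the proof of Proposition 3.3.) -/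
open Matrix Kronecker

/-- `A₂ := 1 ⊗ A` acting on `ℂ^N ⊗ ℂ^N`. -/
noncomputable def emb2 {N : ℕ} (A : Matrix (Fin N) (Fin N) ℂ) :
    Matrix (Fin N × Fin N) (Fin N × Fin N) ℂ :=
  (1 : Matrix (Fin N) (Fin N) ℂ) ⊗ₖ A

theorem emb2_mul {N : ℕ} (A B : Matrix (Fin N) (Fin N) ℂ) :
    emb2 (A * B) = emb2 A * emb2 B := by
  simp only [emb2, ← Matrix.mul_kronecker_mul, mul_one]

/-- First step of the proof of Proposition 3.3: if `S` is unitary and `R` satisfies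
the boundary Yang–Baxter equation (rr1), then `T(χ) := R(χ)·R(−χ)` satisfies the
transmission Yang–Baxter equation (tt1) and the transmission–reflection
Yang–Baxter equation (tr1). -/
theorem stmt0 (N : ℕ) (hN : 1 ≤ N)
    (S : ℝ → ℝ → Matrix (Fin N × Fin N) (Fin N × Fin N) ℂ)
    (R : ℝ → Matrix (Fin N) (Fin N) ℂ)
    (unit1 : ∀ χ₁ χ₂ : ℝ, S χ₁ χ₂ * S χ₂ χ₁ = 1)
    (rr1 : ∀ χ₁ χ₂ : ℝ,
      S χ₁ χ₂ * emb2 (R χ₁) * S χ₂ (-χ₁) * emb2 (R χ₂)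
        = emb2 (R χ₂) * S χ₁ (-χ₂) * emb2 (R χ₁) * S (-χ₂) (-χ₁)) :
    (∀ χ₁ χ₂ : ℝ,
      S χ₁ χ₂ * emb2 (R χ₁ * R (-χ₁)) * S χ₂ χ₁ * emb2 (R χ₂ * R (-χ₂))
        = emb2 (R χ₂ * R (-χ₂)) * S χ₁ χ₂ * emb2 (R χ₁ * R (-χ₁)) * S χ₂ χ₁)
    ∧ (∀ χ₁ χ₂ : ℝ,
      S χ₁ χ₂ * emb2 (R χ₁ * R (-χ₁)) * S χ₂ χ₁ * emb2 (R χ₂)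
        = emb2 (R χ₂) * S χ₁ (-χ₂) * emb2 (R χ₁ * R (-χ₁)) * S (-χ₂) χ₁) := by
  have tr1 : ∀ a b : ℝ,
      S a b * emb2 (R a * R (-a)) * S b a * emb2 (R b)
        = emb2 (R b) * S a (-b) * emb2 (R a * R (-a)) * S (-b) a := by
    intro a b
    have h := rr1 (-a) b
    rw [neg_neg] at h
    calc S a b * emb2 (R a * R (-a)) * S b a * emb2 (R b)
        = S a b * emb2 (R a) * (S b (-a) * S (-a) b) * emb2 (R (-a)) * S b a * emb2 (R b) := by
          rw [unit1, emb2_mul, mul_one]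
          simp only [mul_assoc]
      _ = S a b * emb2 (R a) * S b (-a) *
            (S (-a) b * emb2 (R (-a)) * S b a * emb2 (R b)) := by
          simp only [mul_assoc]
      _ = S a b * emb2 (R a) * S b (-a) * emb2 (R b) *
            (S (-a) (-b) * emb2 (R (-a)) * S (-b) a) := by
          rw [h]
          simp only [mul_assoc]
      _ = emb2 (R b) * S a (-b) * emb2 (R a) * (S (-b) (-a) * S (-a) (-b)) *
            emb2 (R (-a)) * S (-b) a := by
          rw [rr1]
          simp only [mul_assoc]
      _ = emb2 (R b) * S a (-b) * emb2 (R a * R (-a)) * S (-b) a := by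
          rw [unit1, emb2_mul, mul_one]
          simp only [mul_assoc]
  refine ⟨fun a b => ?_, tr1⟩
  have h := tr1 a (-b)
  rw [neg_neg] at h
  calc S a b * emb2 (R a * R (-a)) * S b a * emb2 (R b * R (-b))
      = S a b * emb2 (R a * R (-a)) * S b a * emb2 (R b) * emb2 (R (-b)) := by
        rw [emb2_mul (R b), ← mul_assoc]
    _ = emb2 (R b) * (S a (-b) * emb2 (R a * R (-a)) * S (-b) a * emb2 (R (-b))) := by
        rw [tr1]
        simp only [mul_assoc]
    _ = emb2 (R b * R (-b)) * S a b * emb2 (R a * R (-a)) * S b a := by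
        rw [h, emb2_mul (R b)]
        simp only [mul_assoc]
end

section
/- Let S₁₂ satisfy (unit1), and let T, R : ℝ → M satisfy (tt1) and (tr1). Then for all integers m, n ≥ 1 and all χ₁,χ₂ ∈ ℝ the following identities hold: (Tid1) S₁₂(χ₁,χ₂)[T₂(χ₁)]^m S₁₂(χ₂,χ₁)[T₂(χ₂)]^n = [T₂(χ₂)]^n S₁₂(χ₁,χ₂)[T₂(χ₁)]^m S₁₂(χ₂,χ₁), and (Tid2) S₁₂(χ₁,χ₂)[T₂(χ₁)]^n S₁₂(χ₂,χ₁)R₂(χ₂) = R₂(χ₂)S₁₂(χ₁,−χ₂)[T₂(χ₁)]^n S₁₂(−χ₂,χ₁). -/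
open Matrix Kronecker

theorem emb2_pow {N : ℕ} (A : Matrix (Fin N) (Fin N) ℂ) (n : ℕ) :
    emb2 (A ^ n) = emb2 A ^ n := by
  induction n with
  | zero => simp [emb2]
  | succ k ih =>
    rw [pow_succ, pow_succ, ← ih]
    simp only [emb2, ← Matrix.mul_kronecker_mul, one_mul]

theorem mul_pow_mul_of_mul_eq_one {M : Type*} [Monoid M] {u v : M} (huv : u * v = 1)
    (hvu : v * u = 1) (a : M) (n : ℕ) : u * a ^ n * v = (u * a * v) ^ n :=
  (Units.conj_pow ⟨u, v, huv, hvu⟩ a n).symm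

/-- Identities (Tid1) and (Tid2): if `S` is unitary and `T, R` satisfy (tt1) and (tr1),
then the same identities hold with arbitrary positive powers of `T`. -/
theorem stmt1 (N : ℕ) (hN : 1 ≤ N)
    (S : ℝ → ℝ → Matrix (Fin N × Fin N) (Fin N × Fin N) ℂ)
    (T R : ℝ → Matrix (Fin N) (Fin N) ℂ)
    (unit1 : ∀ χ₁ χ₂ : ℝ, S χ₁ χ₂ * S χ₂ χ₁ = 1)
    (tt1 : ∀ χ₁ χ₂ : ℝ,
      S χ₁ χ₂ * emb2 (T χ₁) * S χ₂ χ₁ * emb2 (T χ₂)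
        = emb2 (T χ₂) * S χ₁ χ₂ * emb2 (T χ₁) * S χ₂ χ₁)
    (tr1 : ∀ χ₁ χ₂ : ℝ,
      S χ₁ χ₂ * emb2 (T χ₁) * S χ₂ χ₁ * emb2 (R χ₂)
        = emb2 (R χ₂) * S χ₁ (-χ₂) * emb2 (T χ₁) * S (-χ₂) χ₁) :
    (∀ (m n : ℕ), 1 ≤ m → 1 ≤ n → ∀ χ₁ χ₂ : ℝ,
      S χ₁ χ₂ * emb2 (T χ₁ ^ m) * S χ₂ χ₁ * emb2 (T χ₂ ^ n)
        = emb2 (T χ₂ ^ n) * S χ₁ χ₂ * emb2 (T χ₁ ^ m) * S χ₂ χ₁)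
    ∧ (∀ n : ℕ, 1 ≤ n → ∀ χ₁ χ₂ : ℝ,
      S χ₁ χ₂ * emb2 (T χ₁ ^ n) * S χ₂ χ₁ * emb2 (R χ₂)
        = emb2 (R χ₂) * S χ₁ (-χ₂) * emb2 (T χ₁ ^ n) * S (-χ₂) χ₁) := by
  have conj_pow (x y : ℝ) (A : Matrix (Fin N) (Fin N) ℂ) (n : ℕ) :
      S x y * emb2 (A ^ n) * S y x = (S x y * emb2 A * S y x) ^ n := by
    rw [emb2_pow, mul_pow_mul_of_mul_eq_one (unit1 x y) (unit1 y x)]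
  constructor
  · intro m n _ _ x y
    have h : Commute (S x y * emb2 (T x) * S y x) (emb2 (T y)) := by
      simpa only [Commute, SemiconjBy, mul_assoc] using tt1 x y
    have h_pow := (h.pow_pow m n).eq
    rw [← conj_pow, ← emb2_pow] at h_pow
    simpa only [mul_assoc] using h_pow
  · intro n _ x y
    have h : SemiconjBy (emb2 (R y)) (S x (-y) * emb2 (T x) * S (-y) x)
        (S x y * emb2 (T x) * S y x) := by
      simpa only [SemiconjBy, mul_assoc] using (tr1 x y).symm
    have h_pow := (h.pow_right n).eq
    rw [← conj_pow, ← conj_pow] at h_pow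
    simpa only [mul_assoc] using h_pow.symm
end

section
/- Let S₁₂ satisfy (unit1) and let R : ℝ → M satisfy the boundary Yang–Baxter equation (rr1). Then for every polynomial p with complex coefficients and every function τ : ℝ → ℂ, the matrix function T(χ) := τ(χ)·p(R(χ)·R(−χ)) (where p is evaluated on the matrix R(χ)R(−χ)) satisfies the transmission Yang–Baxter equation (tt1) and the transmission–reflection Yang–Baxter equation (tr1). (Proposition 3.3, including the remark that the conclusion holds for any series in powers of R(χ)R(−χ).) -/
open Matrix Kronecker

lemma Commute.aeval_right {K A : Type*} [CommSemiring K] [Semiring A] [Algebra K A]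
    {x a : A} (h : Commute x a) (p : Polynomial K) :
    Commute x (Polynomial.aeval a p) := by
  induction p using Polynomial.induction_on' with
  | add p q hp hq => simpa using hp.add_right hq
  | monomial n c =>
    rw [Polynomial.aeval_monomial]
    exact (Algebra.commute_algebraMap_right c x).mul_right (h.pow_right n)

section

variable {A : Type*} [Ring A] {S : ℝ → ℝ → A} {r : ℝ → A}

lemma reflection_transport (unit : ∀ a b, S a b * S b a = 1)
    (rr : ∀ a b, S a b * r a * S b (-a) * r b = r b * S a (-b) * r a * S (-b) (-a))
    (a b : ℝ) :
    S a b * (r a * r (-a)) * S b a * r b = r b * S a (-b) * (r a * r (-a)) * S (-b) a := by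
  have h := rr (-a) b
  rw [neg_neg] at h
  calc S a b * (r a * r (-a)) * S b a * r b
      = S a b * r a * (S b (-a) * S (-a) b) * r (-a) * S b a * r b := by
        rw [unit]; noncomm_ring
    _ = S a b * r a * S b (-a) * (S (-a) b * r (-a) * S b a * r b) := by noncomm_ring
    _ = (S a b * r a * S b (-a) * r b) * S (-a) (-b) * r (-a) * S (-b) a := by
        rw [h]; noncomm_ring
    _ = r b * S a (-b) * r a * (S (-b) (-a) * S (-a) (-b)) * r (-a) * S (-b) a := by
        rw [rr]; noncomm_ring
    _ = r b * S a (-b) * (r a * r (-a)) * S (-b) a := by rw [unit]; noncomm_ring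

lemma reflection_transport_iff_commute (unit : ∀ a b, S a b * S b a = 1) (a b : ℝ) (x : A) :
    S a b * x * S b a * r b = r b * S a (-b) * x * S (-b) a ↔
      Commute x (S b a * r b * S a (-b)) := by
  constructor
  · intro h
    calc x * (S b a * r b * S a (-b))
        = S b a * S a b * x * (S b a * r b * S a (-b)) := by rw [unit, one_mul]
      _ = S b a * (S a b * x * S b a * r b) * S a (-b) := by noncomm_ring
      _ = S b a * r b * S a (-b) * x * (S (-b) a * S a (-b)) := by rw [h]; noncomm_ring
      _ = S b a * r b * S a (-b) * x := by rw [unit, mul_one]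
  · intro h
    calc S a b * x * S b a * r b
        = S a b * x * S b a * r b * (S a (-b) * S (-b) a) := by rw [unit, mul_one]
      _ = S a b * (x * (S b a * r b * S a (-b))) * S (-b) a := by noncomm_ring
      _ = (S a b * S b a) * r b * S a (-b) * x * S (-b) a := by rw [h.eq]; noncomm_ring
      _ = r b * S a (-b) * x * S (-b) a := by rw [unit, one_mul]

variable {K : Type*} [CommSemiring K] [Algebra K A]

lemma aeval_reflection_transport (unit : ∀ a b, S a b * S b a = 1)
    (rr : ∀ a b, S a b * r a * S b (-a) * r b = r b * S a (-b) * r a * S (-b) (-a))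
    (p : Polynomial K) (a b : ℝ) :
    S a b * Polynomial.aeval (r a * r (-a)) p * S b a * r b =
      r b * S a (-b) * Polynomial.aeval (r a * r (-a)) p * S (-b) a := by
  rw [reflection_transport_iff_commute unit]
  exact (((reflection_transport_iff_commute unit a b _).1
    (reflection_transport unit rr a b)).symm.aeval_right p).symm

lemma commute_conj_aeval_aeval (unit : ∀ a b, S a b * S b a = 1)
    (rr : ∀ a b, S a b * r a * S b (-a) * r b = r b * S a (-b) * r a * S (-b) (-a))
    (p : Polynomial K) (a b : ℝ) :
    Commute (S a b * Polynomial.aeval (r a * r (-a)) p * S b a)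
      (Polynomial.aeval (r b * r (-b)) p) := by
  refine Commute.aeval_right ?_ p
  have h := aeval_reflection_transport unit rr p a (-b)
  rw [neg_neg] at h
  rw [commute_iff_eq, ← mul_assoc, aeval_reflection_transport unit rr p a b]
  simp only [mul_assoc] at h ⊢
  rw [h]

end

/-- `A ↦ 1 ⊗ A` as an algebra homomorphism. -/
noncomputable def emb2AlgHom (N : ℕ) :
    Matrix (Fin N) (Fin N) ℂ →ₐ[ℂ] Matrix (Fin N × Fin N) (Fin N × Fin N) ℂ :=
  AlgHom.ofLinearMap
    { toFun := emb2
      map_add' := fun A B => Matrix.kronecker_add 1 A B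
      map_smul' := fun c A => Matrix.kronecker_smul c 1 A }
    Matrix.one_kronecker_one
    (fun A B => by
      change (1 : Matrix (Fin N) (Fin N) ℂ) ⊗ₖ (A * B) = (1 ⊗ₖ A) * (1 ⊗ₖ B)
      rw [← Matrix.mul_kronecker_mul, one_mul])

lemma emb2_smul_aeval {N : ℕ} (c : ℂ) (A B : Matrix (Fin N) (Fin N) ℂ) (p : Polynomial ℂ) :
    emb2 (c • Polynomial.aeval (A * B) p) = c • Polynomial.aeval (emb2 A * emb2 B) p := by
  change emb2AlgHom N _ = c • Polynomial.aeval (emb2AlgHom N A * emb2AlgHom N B) p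
  rw [map_smul, ← map_mul, Polynomial.aeval_algHom_apply]

/-- Proposition 3.3 (including the remark after the proof): if `S` is unitary and `R`
satisfies the boundary Yang–Baxter equation (rr1), then for any polynomial `p` and any
scalar function `τ`, the matrix function `T(χ) := τ(χ) • p(R(χ)·R(−χ))` satisfies the
transmission Yang–Baxter equation (tt1) and the transmission–reflection Yang–Baxter
equation (tr1). -/
theorem stmt2 (N : ℕ) (hN : 1 ≤ N)
    (S : ℝ → ℝ → Matrix (Fin N × Fin N) (Fin N × Fin N) ℂ)
    (R : ℝ → Matrix (Fin N) (Fin N) ℂ)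
    (unit1 : ∀ χ₁ χ₂ : ℝ, S χ₁ χ₂ * S χ₂ χ₁ = 1)
    (rr1 : ∀ χ₁ χ₂ : ℝ,
      S χ₁ χ₂ * emb2 (R χ₁) * S χ₂ (-χ₁) * emb2 (R χ₂)
        = emb2 (R χ₂) * S χ₁ (-χ₂) * emb2 (R χ₁) * S (-χ₂) (-χ₁))
    (p : Polynomial ℂ) (τ : ℝ → ℂ)
    (T : ℝ → Matrix (Fin N) (Fin N) ℂ)
    (hT : ∀ χ : ℝ, T χ = τ χ • (Polynomial.aeval (R χ * R (-χ)) p)) :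
    (∀ χ₁ χ₂ : ℝ,
      S χ₁ χ₂ * emb2 (T χ₁) * S χ₂ χ₁ * emb2 (T χ₂)
        = emb2 (T χ₂) * S χ₁ χ₂ * emb2 (T χ₁) * S χ₂ χ₁)
    ∧ (∀ χ₁ χ₂ : ℝ,
      S χ₁ χ₂ * emb2 (T χ₁) * S χ₂ χ₁ * emb2 (R χ₂)
        = emb2 (R χ₂) * S χ₁ (-χ₂) * emb2 (T χ₁) * S (-χ₂) χ₁) := by
  simp only [hT, emb2_smul_aeval]
  refine ⟨fun a b => ?_, fun a b => ?_⟩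
  · have h := (commute_conj_aeval_aeval (r := fun χ => emb2 (R χ)) unit1 rr1 p a b).eq
    simp only [mul_smul_comm, smul_mul_assoc, mul_assoc] at h ⊢
    rw [h, smul_comm]
  · have h := aeval_reflection_transport (r := fun χ => emb2 (R χ)) unit1 rr1 p a b
    simp only [mul_smul_comm, smul_mul_assoc]
    rw [h]
end

section
/- Let S₁₂ satisfy (unit1) and suppose R : ℝ → M satisfies condition (cSR): S₁₂(χ₁,χ₂)R₂(χ₁) = R₁(χ₁)S₁₂(−χ₁,χ₂) for all χ₁,χ₂ ∈ ℝ. Then R satisfies the boundary Yang–Baxter equation (rr1): S₁₂(χ₁,χ₂)R₂(χ₁)S₁₂(χ₂,−χ₁)R₂(χ₂) = R₂(χ₂)S₁₂(χ₁,−χ₂)R₂(χ₁)S₁₂(−χ₂,−χ₁) for all χ₁,χ₂. (First part of Proposition 3.6.) -/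
open Matrix Kronecker

/-- `A₁ := A ⊗ 1` acting on `ℂ^N ⊗ ℂ^N`. -/
noncomputable def emb1 {N : ℕ} (A : Matrix (Fin N) (Fin N) ℂ) :
    Matrix (Fin N × Fin N) (Fin N × Fin N) ℂ :=
  A ⊗ₖ (1 : Matrix (Fin N) (Fin N) ℂ)

theorem emb1_commute_emb2 {N : ℕ} (A B : Matrix (Fin N) (Fin N) ℂ) :
    Commute (emb1 A) (emb2 B) := by
  simp [Commute, SemiconjBy, emb1, emb2, ← mul_kronecker_mul]

/-- First part of Proposition 3.6: if `S` is unitary and `R` satisfies condition (cSR),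
then `R` satisfies the boundary Yang–Baxter equation (rr1). -/
theorem stmt3 (N : ℕ) (hN : 1 ≤ N)
    (S : ℝ → ℝ → Matrix (Fin N × Fin N) (Fin N × Fin N) ℂ)
    (R : ℝ → Matrix (Fin N) (Fin N) ℂ)
    (unit1 : ∀ χ₁ χ₂ : ℝ, S χ₁ χ₂ * S χ₂ χ₁ = 1)
    (cSR : ∀ χ₁ χ₂ : ℝ, S χ₁ χ₂ * emb2 (R χ₁) = emb1 (R χ₁) * S (-χ₁) χ₂) :
    ∀ χ₁ χ₂ : ℝ,
      S χ₁ χ₂ * emb2 (R χ₁) * S χ₂ (-χ₁) * emb2 (R χ₂)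
        = emb2 (R χ₂) * S χ₁ (-χ₂) * emb2 (R χ₁) * S (-χ₂) (-χ₁) := by
  intro χ₁ χ₂
  rw [cSR, mul_assoc (emb1 (R χ₁)), unit1, mul_one, mul_assoc (emb2 (R χ₂)), cSR,
    mul_assoc (emb2 (R χ₂)), mul_assoc (emb1 (R χ₁)), unit1, mul_one]
  exact emb1_commute_emb2 _ _
end

section
/- Suppose R : ℝ → M satisfies condition (cSR): S₁₂(χ₁,χ₂)R₂(χ₁) = R₁(χ₁)S₁₂(−χ₁,χ₂) for all χ₁,χ₂ ∈ ℝ. Then for every polynomial p with complex coefficients and every function τ : ℝ → ℂ, the matrix function T(χ) := τ(χ)·p(R(χ)·R(−χ)) satisfies condition (cST): S₁₂(χ₁,χ₂)T₂(χ₁) = T₁(χ₁)S₁₂(χ₁,χ₂) for all χ₁,χ₂ ∈ ℝ. (Second part of Proposition 3.6.) -/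
open Matrix Kronecker

theorem emb1_mul {N : ℕ} (A B : Matrix (Fin N) (Fin N) ℂ) :
    emb1 (A * B) = emb1 A * emb1 B := by
  simp [emb1, ← Matrix.mul_kronecker_mul]

theorem emb1_add {N : ℕ} (A B : Matrix (Fin N) (Fin N) ℂ) :
    emb1 (A + B) = emb1 A + emb1 B :=
  Matrix.add_kronecker A B 1

theorem emb2_add {N : ℕ} (A B : Matrix (Fin N) (Fin N) ℂ) :
    emb2 (A + B) = emb2 A + emb2 B :=
  Matrix.kronecker_add 1 A B

theorem emb1_smul {N : ℕ} (c : ℂ) (A : Matrix (Fin N) (Fin N) ℂ) :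
    emb1 (c • A) = c • emb1 A :=
  Matrix.smul_kronecker c A 1

theorem emb2_smul {N : ℕ} (c : ℂ) (A : Matrix (Fin N) (Fin N) ℂ) :
    emb2 (c • A) = c • emb2 A :=
  Matrix.kronecker_smul c 1 A

theorem emb1_one {N : ℕ} : emb1 (1 : Matrix (Fin N) (Fin N) ℂ) = 1 :=
  Matrix.one_kronecker_one

theorem emb2_one {N : ℕ} : emb2 (1 : Matrix (Fin N) (Fin N) ℂ) = 1 :=
  Matrix.one_kronecker_one

/-- A matrix intertwining `A₂` with `A₁` intertwines `p(A)₂` with `p(A)₁`. -/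
theorem mul_emb2_aeval {N : ℕ} {S : Matrix (Fin N × Fin N) (Fin N × Fin N) ℂ}
    {A : Matrix (Fin N) (Fin N) ℂ} (h : S * emb2 A = emb1 A * S) (p : Polynomial ℂ) :
    S * emb2 (Polynomial.aeval A p) = emb1 (Polynomial.aeval A p) * S := by
  induction p using Polynomial.induction_on' with
  | add p q hp hq => rw [map_add, emb1_add, emb2_add, mul_add, add_mul, hp, hq]
  | monomial n a =>
    have hpow : S * emb2 (A ^ n) = emb1 (A ^ n) * S := by
      induction n with
      | zero => rw [pow_zero, emb1_one, emb2_one, mul_one, one_mul]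
      | succ n ih =>
        rw [pow_succ, emb1_mul, emb2_mul, ← mul_assoc, ih, mul_assoc, h, mul_assoc]
    rw [Polynomial.aeval_monomial, ← Algebra.smul_def, emb1_smul, emb2_smul, mul_smul_comm,
      smul_mul_assoc, hpow]

/-- Second part of Proposition 3.6: if `R` satisfies condition (cSR), then for any
polynomial `p` and scalar function `τ`, the matrix function
`T(χ) := τ(χ) • p(R(χ)·R(−χ))` satisfies condition (cST). -/
theorem stmt4 (N : ℕ) (hN : 1 ≤ N)
    (S : ℝ → ℝ → Matrix (Fin N × Fin N) (Fin N × Fin N) ℂ)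
    (R : ℝ → Matrix (Fin N) (Fin N) ℂ)
    (cSR : ∀ χ₁ χ₂ : ℝ, S χ₁ χ₂ * emb2 (R χ₁) = emb1 (R χ₁) * S (-χ₁) χ₂)
    (p : Polynomial ℂ) (τ : ℝ → ℂ)
    (T : ℝ → Matrix (Fin N) (Fin N) ℂ)
    (hT : ∀ χ : ℝ, T χ = τ χ • (Polynomial.aeval (R χ * R (-χ)) p)) :
    ∀ χ₁ χ₂ : ℝ, S χ₁ χ₂ * emb2 (T χ₁) = emb1 (T χ₁) * S χ₁ χ₂ := by
  intro χ₁ χ₂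
  have h : S χ₁ χ₂ * emb2 (R χ₁ * R (-χ₁)) = emb1 (R χ₁ * R (-χ₁)) * S χ₁ χ₂ := by
    have hneg := cSR (-χ₁) χ₂
    rw [neg_neg] at hneg
    rw [emb1_mul, emb2_mul, ← mul_assoc, cSR, mul_assoc, hneg, mul_assoc]
  rw [hT, emb1_smul, emb2_smul, mul_smul_comm, smul_mul_assoc, mul_emb2_aeval h]
end

section
/- Let S₁₂ satisfy (unit1), and suppose R⁺, R⁻ : ℝ → M both satisfy condition (SR): S₁₂(χ₁,χ₂)R^±₂(χ₁) = R^±₁(χ₁)S₁₂(−χ₁,χ₂) for all χ₁,χ₂. Then for arbitrary T⁺, T⁻ : ℝ → M all of the following factorization equations hold for all χ₁,χ₂ ∈ ℝ: (SRSR+) S₁₂(χ₁,χ₂)R⁺₂(χ₁)S₁₂(χ₂,−χ₁)R⁺₂(χ₂) = R⁺₂(χ₂)S₁₂(χ₁,−χ₂)R⁺₂(χ₁)S₁₂(−χ₂,−χ₁); (SRSR−) S₁₂(χ₁,χ₂)R⁻₁(χ₂)S₁₂(−χ₂,χ₁)R⁻₁(χ₁) = R⁻₁(χ₁)S₁₂(−χ₁,χ₂)R⁻₁(χ₂)S₁₂(−χ₂,−χ₁);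 (TSRS+) R⁺₁(χ₁)T⁻₂(χ₂) = T⁻₂(χ₂)S₁₂(χ₁,χ₂)R⁺₂(χ₁)S₁₂(χ₂,−χ₁); (TSRS−) T⁺₁(χ₁)R⁻₂(χ₂) = T⁺₁(χ₁)S₁₂(χ₁,χ₂)R⁻₁(χ₂)S₁₂(−χ₂,χ₁); (SRST+) R⁺₁(χ₁)T⁺₂(χ₂) = S₁₂(χ₁,χ₂)R⁺₂(χ₁)S₁₂(χ₂,−χ₁)T⁺₂(χ₂); (SRST−) T⁻₁(χ₁)R⁻₂(χ₂) = S₁₂(χ₁,χ₂)R⁻₁(χ₂)S₁₂(−χ₂,χ₁)T⁻₁(χ₁); (TSR+) R⁺₁(χ₁)T⁻₂(χ₂)S₁₂(−χ₁,χ₂) = T⁻₂(χ₂)S₁₂(χ₁,χ₂)R⁺₂(χ₁); (TSR−) T⁺₁(χ₁)R⁻₂(χ₂)S₁₂(χ₁,−χ₂) = T⁺₁(χ₁)S₁₂(χ₁,χ₂)R⁻₁(χ₂); (RST+) R⁺₂(χ₁)S₁₂(χ₂,−χ₁)T⁺₂(χ₂) = S₁₂(χ₂,χ₁)R⁺₁(χ₁)T⁺₂(χ₂);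 (RST−) R⁻₁(χ₂)S₁₂(−χ₂,χ₁)T⁻₁(χ₁) = S₁₂(χ₂,χ₁)T⁻₁(χ₁)R⁻₂(χ₂). -/
open Matrix Kronecker

theorem emb1_mul_emb2_comm {N : ℕ} (A B : Matrix (Fin N) (Fin N) ℂ) :
    emb1 A * emb2 B = emb2 B * emb1 A := by
  simp [emb1, emb2, ← Matrix.mul_kronecker_mul]

/-- Conjugating the reflection matrix in the second space yields the one in the first space. -/
theorem exchange_emb2_exchange {N : ℕ}
    {S : ℝ → ℝ → Matrix (Fin N × Fin N) (Fin N × Fin N) ℂ}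
    {R : ℝ → Matrix (Fin N) (Fin N) ℂ}
    (unit1 : ∀ χ₁ χ₂ : ℝ, S χ₁ χ₂ * S χ₂ χ₁ = 1)
    (hR : ∀ χ₁ χ₂ : ℝ, S χ₁ χ₂ * emb2 (R χ₁) = emb1 (R χ₁) * S (-χ₁) χ₂) (a b : ℝ) :
    S a b * (emb2 (R a) * S b (-a)) = emb1 (R a) := by
  rw [← mul_assoc, hR, mul_assoc, unit1, mul_one]

/-- Conjugating the reflection matrix in the first space yields the one in the second space. -/
theorem exchange_emb1_exchange {N : ℕ}
    {S : ℝ → ℝ → Matrix (Fin N × Fin N) (Fin N × Fin N) ℂ}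
    {R : ℝ → Matrix (Fin N) (Fin N) ℂ}
    (unit1 : ∀ χ₁ χ₂ : ℝ, S χ₁ χ₂ * S χ₂ χ₁ = 1)
    (hR : ∀ χ₁ χ₂ : ℝ, S χ₁ χ₂ * emb2 (R χ₁) = emb1 (R χ₁) * S (-χ₁) χ₂) (a b : ℝ) :
    S a b * (emb1 (R b) * S (-b) a) = emb2 (R b) := by
  rw [← hR, ← mul_assoc, unit1, one_mul]

/-- If `S` is unitary and `R⁺`, `R⁻` satisfy (SR), then all the mixed and pure-reflection
factorization conditions (SRSR±), (TSRS±), (SRST±), (TSR±), (RST±) hold. -/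
theorem stmt9 (N : ℕ) (hN : 1 ≤ N)
    (S : ℝ → ℝ → Matrix (Fin N × Fin N) (Fin N × Fin N) ℂ)
    (Rp Rm Tp Tm : ℝ → Matrix (Fin N) (Fin N) ℂ)
    (unit1 : ∀ χ₁ χ₂ : ℝ, S χ₁ χ₂ * S χ₂ χ₁ = 1)
    (SRp : ∀ χ₁ χ₂ : ℝ, S χ₁ χ₂ * emb2 (Rp χ₁) = emb1 (Rp χ₁) * S (-χ₁) χ₂)
    (SRm : ∀ χ₁ χ₂ : ℝ, S χ₁ χ₂ * emb2 (Rm χ₁) = emb1 (Rm χ₁) * S (-χ₁) χ₂) :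
    (∀ χ₁ χ₂ : ℝ,
      S χ₁ χ₂ * emb2 (Rp χ₁) * S χ₂ (-χ₁) * emb2 (Rp χ₂)
        = emb2 (Rp χ₂) * S χ₁ (-χ₂) * emb2 (Rp χ₁) * S (-χ₂) (-χ₁)) ∧
    (∀ χ₁ χ₂ : ℝ,
      S χ₁ χ₂ * emb1 (Rm χ₂) * S (-χ₂) χ₁ * emb1 (Rm χ₁)
        = emb1 (Rm χ₁) * S (-χ₁) χ₂ * emb1 (Rm χ₂) * S (-χ₂) (-χ₁)) ∧
    (∀ χ₁ χ₂ : ℝ,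
      emb1 (Rp χ₁) * emb2 (Tm χ₂)
        = emb2 (Tm χ₂) * S χ₁ χ₂ * emb2 (Rp χ₁) * S χ₂ (-χ₁)) ∧
    (∀ χ₁ χ₂ : ℝ,
      emb1 (Tp χ₁) * emb2 (Rm χ₂)
        = emb1 (Tp χ₁) * S χ₁ χ₂ * emb1 (Rm χ₂) * S (-χ₂) χ₁) ∧
    (∀ χ₁ χ₂ : ℝ,
      emb1 (Rp χ₁) * emb2 (Tp χ₂)
        = S χ₁ χ₂ * emb2 (Rp χ₁) * S χ₂ (-χ₁) * emb2 (Tp χ₂)) ∧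
    (∀ χ₁ χ₂ : ℝ,
      emb1 (Tm χ₁) * emb2 (Rm χ₂)
        = S χ₁ χ₂ * emb1 (Rm χ₂) * S (-χ₂) χ₁ * emb1 (Tm χ₁)) ∧
    (∀ χ₁ χ₂ : ℝ,
      emb1 (Rp χ₁) * emb2 (Tm χ₂) * S (-χ₁) χ₂
        = emb2 (Tm χ₂) * S χ₁ χ₂ * emb2 (Rp χ₁)) ∧
    (∀ χ₁ χ₂ : ℝ,
      emb1 (Tp χ₁) * emb2 (Rm χ₂) * S χ₁ (-χ₂)
        = emb1 (Tp χ₁) * S χ₁ χ₂ * emb1 (Rm χ₂)) ∧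
    (∀ χ₁ χ₂ : ℝ,
      emb2 (Rp χ₁) * S χ₂ (-χ₁) * emb2 (Tp χ₂)
        = S χ₂ χ₁ * emb1 (Rp χ₁) * emb2 (Tp χ₂)) ∧
    (∀ χ₁ χ₂ : ℝ,
      emb1 (Rm χ₂) * S (-χ₂) χ₁ * emb1 (Tm χ₁)
        = S χ₂ χ₁ * emb1 (Tm χ₁) * emb2 (Rm χ₂)) := by
  have hp := exchange_emb2_exchange unit1 SRp
  have hm := exchange_emb1_exchange unit1 SRm
  refine ⟨fun a b => ?_, fun a b => ?_, fun a b => ?_, fun a b => ?_, fun a b => ?_,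
    fun a b => ?_, fun a b => ?_, fun a b => ?_, fun a b => ?_, fun a b => ?_⟩
  · have h := hp a (-b)
    rw [mul_assoc (S a b), hp, mul_assoc (emb2 _), mul_assoc (emb2 _), mul_assoc (S a (-b)), h,
      emb1_mul_emb2_comm]
  · have h := hm (-a) b
    rw [mul_assoc (S a b), hm, mul_assoc (emb1 _), mul_assoc (emb1 _), mul_assoc (S (-a) b), h,
      emb1_mul_emb2_comm]
  · rw [mul_assoc, mul_assoc, hp, emb1_mul_emb2_comm]
  · rw [mul_assoc, mul_assoc, hm]
  · rw [mul_assoc (S a b), hp]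
  · rw [mul_assoc (S a b), hm, emb1_mul_emb2_comm]
  · rw [mul_assoc (emb2 _), SRp, emb1_mul_emb2_comm, mul_assoc]
  · rw [mul_assoc, mul_assoc, ← hm a b, mul_assoc (S a b), mul_assoc (emb1 (Rm b)), unit1,
      mul_one]
  · rw [← hp a b, ← mul_assoc (S b a), unit1, one_mul]
  · rw [← SRm, mul_assoc, mul_assoc, emb1_mul_emb2_comm]
end

section
/- Let S : ℝ × ℝ → N²×N² complex matrices and define the doubled exchange matrix 𝒮(χ₁,χ₂), a matrix indexed by pairs from I×I where I := {+,−} × {1,…,N}, by its entries 𝒮_{(ξ₁,i₁)(ξ₂,i₂)}^{(η₁,j₁)(η₂,j₂)}(χ₁,χ₂) := δ_{ξ₁,η₂}·δ_{ξ₂,η₁}·S_{i₁i₂}^{j₁j₂}(χ₁,χ₂) (this is the block structure of equation (cS)). Then: (i) if S satisfies unitarity S₁₂(χ₁,χ₂)S₁₂(χ₂,χ₁) = 1 and Hermitian analyticity S₁₂(χ₁,χ₂)† = S₁₂(χ₂,χ₁) for all χ₁,χ₂, then 𝒮 satisfies 𝒮₁₂(χ₁,χ₂)𝒮₁₂(χ₂,χ₁)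 = 1 and 𝒮₁₂(χ₁,χ₂)† = 𝒮₁₂(χ₂,χ₁); and (ii) if S additionally satisfies the braid-form quantum Yang–Baxter equation S₁₂(χ₁,χ₂)S₂₃(χ₁,χ₃)S₁₂(χ₂,χ₃) = S₂₃(χ₂,χ₃)S₁₂(χ₁,χ₃)S₂₃(χ₁,χ₂), then 𝒮 satisfies the same braid-form Yang–Baxter equation on the triple Kronecker product over the index set I. (Part of Proposition 4.1.) -/
open Matrix

/-- The operator `M ⊗ 1` acting on the triple tensor product, for `M` acting on the
first two factors. -/
noncomputable def lift12 {I : Type*} [DecidableEq I]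
    (M : Matrix (I × I) (I × I) ℂ) : Matrix (I × I × I) (I × I × I) ℂ :=
  fun p q => M (p.1, p.2.1) (q.1, q.2.1) * (if p.2.2 = q.2.2 then 1 else 0)

/-- The operator `1 ⊗ M` acting on the triple tensor product, for `M` acting on the
last two factors. -/
noncomputable def lift23 {I : Type*} [DecidableEq I]
    (M : Matrix (I × I) (I × I) ℂ) : Matrix (I × I × I) (I × I × I) ℂ :=
  fun p q => (if p.1 = q.1 then 1 else 0) * M (p.2.1, p.2.2) (q.2.1, q.2.2)

/-- The doubled exchange matrix `𝒮` of equation (cS), over the index set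
`I = {+,−} × {1,…,N}`:
`𝒮_{(ξ₁,i₁)(ξ₂,i₂)}^{(η₁,j₁)(η₂,j₂)} = δ_{ξ₁,η₂} δ_{ξ₂,η₁} S_{i₁i₂}^{j₁j₂}`. -/
noncomputable def dblS {N : ℕ}
    (S : ℝ → ℝ → Matrix (Fin N × Fin N) (Fin N × Fin N) ℂ) (χ₁ χ₂ : ℝ) :
    Matrix ((Bool × Fin N) × (Bool × Fin N)) ((Bool × Fin N) × (Bool × Fin N)) ℂ :=
  fun a b =>
    (if a.1.1 = b.2.1 then 1 else 0) * (if a.2.1 = b.1.1 then 1 else 0) *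
      S χ₁ χ₂ (a.1.2, a.2.2) (b.1.2, b.2.2)

/-- The matrix exchanging the two factors of a tensor square. -/
abbrev flipMatrix (α : Type*) [DecidableEq α] : Matrix (α × α) (α × α) ℂ :=
  Equiv.Perm.permMatrix ℂ (Equiv.prodComm α α)

open scoped Kronecker in
/-- The doubled exchange matrix is, after regrouping the indices, the Kronecker product of the
flip on `ℂ² ⊗ ℂ²` with `S`. -/
theorem dblS_eq_submatrix {N : ℕ}
    (S : ℝ → ℝ → Matrix (Fin N × Fin N) (Fin N × Fin N) ℂ) (χ₁ χ₂ : ℝ) :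
    dblS S χ₁ χ₂ = (flipMatrix Bool ⊗ₖ S χ₁ χ₂).submatrix
      (Equiv.prodProdProdComm Bool (Fin N) Bool (Fin N))
      (Equiv.prodProdProdComm Bool (Fin N) Bool (Fin N)) := by
  ext ⟨⟨a, i⟩, b, j⟩ ⟨⟨c, k⟩, d, l⟩
  by_cases had : a = d <;> by_cases hbc : b = c <;>
    simp [dblS, PEquiv.toMatrix_apply, had, hbc]

/-- Regrouping of the factors of a triple product of products. -/
def tripleProdComm (α β : Type*) :
    (α × β) × (α × β) × (α × β) ≃ (α × α × α) × (β × β × β) :=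
  ((Equiv.refl _).prodCongr (Equiv.prodProdProdComm α β α β)).trans
    (Equiv.prodProdProdComm α β (α × α) (β × β))

section Lift

variable {α β : Type*} [DecidableEq α] [DecidableEq β]

open scoped Kronecker in
theorem lift12_kronecker_submatrix (A : Matrix (α × α) (α × α) ℂ) (B : Matrix (β × β) (β × β) ℂ) :
    lift12 ((A ⊗ₖ B).submatrix (Equiv.prodProdProdComm α β α β) (Equiv.prodProdProdComm α β α β)) =
      (lift12 A ⊗ₖ lift12 B).submatrix (tripleProdComm α β) (tripleProdComm α β) := by
  ext ⟨⟨a₁, b₁⟩, ⟨a₂, b₂⟩, a₃, b₃⟩ ⟨⟨c₁, d₁⟩, ⟨c₂, d₂⟩, c₃, d₃⟩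
  by_cases hac : a₃ = c₃ <;> by_cases hbd : b₃ = d₃ <;>
    simp [lift12, tripleProdComm, hac, hbd]

open scoped Kronecker in
theorem lift23_kronecker_submatrix (A : Matrix (α × α) (α × α) ℂ) (B : Matrix (β × β) (β × β) ℂ) :
    lift23 ((A ⊗ₖ B).submatrix (Equiv.prodProdProdComm α β α β) (Equiv.prodProdProdComm α β α β)) =
      (lift23 A ⊗ₖ lift23 B).submatrix (tripleProdComm α β) (tripleProdComm α β) := by
  ext ⟨⟨a₁, b₁⟩, ⟨a₂, b₂⟩, a₃, b₃⟩ ⟨⟨c₁, d₁⟩, ⟨c₂, d₂⟩, c₃, d₃⟩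
  by_cases hac : a₁ = c₁ <;> by_cases hbd : b₁ = d₁ <;>
    simp [lift23, tripleProdComm, hac, hbd]

theorem lift12_permMatrix (σ : Equiv.Perm (α × α)) :
    lift12 (σ.permMatrix ℂ) =
      Equiv.Perm.permMatrix ℂ ((Equiv.prodAssoc α α α).permCongr (σ.prodCongr (.refl α))) := by
  ext ⟨a₁, a₂, a₃⟩ ⟨c₁, c₂, c₃⟩
  simp [lift12, PEquiv.toMatrix_apply, Prod.ext_iff, ← ite_and, and_comm, and_left_comm]

theorem lift23_permMatrix (σ : Equiv.Perm (α × α)) :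
    lift23 (σ.permMatrix ℂ) =
      Equiv.Perm.permMatrix ℂ ((Equiv.refl α).prodCongr σ) := by
  ext ⟨a₁, a₂, a₃⟩ ⟨c₁, c₂, c₃⟩
  simp [lift23, PEquiv.toMatrix_apply, Prod.ext_iff, ← ite_and, and_comm]

/-- The flip satisfies the braid relation. -/
theorem lift12_mul_lift23_mul_lift12_prodComm [Fintype α] :
    lift12 (flipMatrix α) * lift23 (flipMatrix α) * lift12 (flipMatrix α) =
      lift23 (flipMatrix α) * lift12 (flipMatrix α) * lift23 (flipMatrix α) := by
  simp only [lift12_permMatrix, lift23_permMatrix, ← Matrix.permMatrix_mul]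
  rfl

end Lift

/-- Part of Proposition 4.1: the doubled exchange matrix `𝒮` inherits unitarity,
Hermitian analyticity and the braid-form quantum Yang–Baxter equation from `S`. -/
theorem stmt10 (N : ℕ) (hN : 1 ≤ N)
    (S : ℝ → ℝ → Matrix (Fin N × Fin N) (Fin N × Fin N) ℂ) :
    ((∀ χ₁ χ₂ : ℝ, S χ₁ χ₂ * S χ₂ χ₁ = 1) →
     (∀ χ₁ χ₂ : ℝ, (S χ₁ χ₂)ᴴ = S χ₂ χ₁) →
      (∀ χ₁ χ₂ : ℝ, dblS S χ₁ χ₂ * dblS S χ₂ χ₁ = 1) ∧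
      (∀ χ₁ χ₂ : ℝ, (dblS S χ₁ χ₂)ᴴ = dblS S χ₂ χ₁))
    ∧ ((∀ χ₁ χ₂ : ℝ, S χ₁ χ₂ * S χ₂ χ₁ = 1) →
       (∀ χ₁ χ₂ : ℝ, (S χ₁ χ₂)ᴴ = S χ₂ χ₁) →
       (∀ χ₁ χ₂ χ₃ : ℝ,
         lift12 (S χ₁ χ₂) * lift23 (S χ₁ χ₃) * lift12 (S χ₂ χ₃)
           = lift23 (S χ₂ χ₃) * lift12 (S χ₁ χ₃) * lift23 (S χ₁ χ₂)) →
       ∀ χ₁ χ₂ χ₃ : ℝ,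
         lift12 (dblS S χ₁ χ₂) * lift23 (dblS S χ₁ χ₃) * lift12 (dblS S χ₂ χ₃)
           = lift23 (dblS S χ₂ χ₃) * lift12 (dblS S χ₁ χ₃) * lift23 (dblS S χ₁ χ₂)) := by
  refine ⟨fun hU hH => ⟨fun χ₁ χ₂ => ?_, fun χ₁ χ₂ => ?_⟩, fun _ _ hY χ₁ χ₂ χ₃ => ?_⟩
  · have hP : flipMatrix Bool * flipMatrix Bool = 1 := by
      rw [← Matrix.permMatrix_mul, ← Matrix.permMatrix_one]
      rfl
    rw [dblS_eq_submatrix, dblS_eq_submatrix, submatrix_mul_equiv, ← mul_kronecker_mul, hP, hU,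
      one_kronecker_one, submatrix_one_equiv]
  · rw [dblS_eq_submatrix, dblS_eq_submatrix, conjTranspose_submatrix, conjTranspose_kronecker, hH,
      Matrix.conjTranspose_permMatrix]
    rfl
  · simp only [dblS_eq_submatrix, lift12_kronecker_submatrix, lift23_kronecker_submatrix,
      submatrix_mul_equiv, ← mul_kronecker_mul, hY, lift12_mul_lift23_mul_lift12_prodComm]
end

section
/- Let g be a nonzero real number, s : ℝ → ℝ a function, and P the flip matrix on ℂ^N ⊗ ℂ^N. The gl(N)-invariant exchange matrix S₁₂(χ₁,χ₂) := ((s(χ₁) − s(χ₂))·P + i·g·1)/(s(χ₁) − s(χ₂) + i·g) satisfies the braid-form quantum Yang–Baxter equation: with S₁₂ := S ⊗ 1 acting on factors 1,2 and S₂₃ := 1 ⊗ S acting on factors 2,3 of ℂ^N ⊗ ℂ^N ⊗ ℂ^N, one has S₁₂(χ₁,χ₂)S₂₃(χ₁,χ₃)S₁₂(χ₂,χ₃) = S₂₃(χ₂,χ₃)S₁₂(χ₁,χ₃)S₂₃(χ₁,χ₂) for all χ₁,χ₂,χ₃ ∈ ℝ. -/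
open Matrix

/-- The flip (permutation) matrix on `ℂ^N ⊗ ℂ^N`. -/
noncomputable def flipP (N : ℕ) : Matrix (Fin N × Fin N) (Fin N × Fin N) ℂ :=
  fun p q => if p.1 = q.2 ∧ p.2 = q.1 then 1 else 0

/-- The `gl(N)`-invariant exchange matrix (equation (Sgln)). -/
noncomputable def glS (N : ℕ) (g : ℝ) (s : ℝ → ℝ) (χ₁ χ₂ : ℝ) :
    Matrix (Fin N × Fin N) (Fin N × Fin N) ℂ :=
  (((s χ₁ : ℂ) - (s χ₂ : ℂ) + Complex.I * g)⁻¹) •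
    (((s χ₁ : ℂ) - (s χ₂ : ℂ)) • flipP N + (Complex.I * g) • 1)

/-- The permutation of the triple index set exchanging the first two components. -/
def swap12 (I : Type*) : Equiv.Perm (I × I × I) where
  toFun p := (p.2.1, p.1, p.2.2)
  invFun p := (p.2.1, p.1, p.2.2)

/-- The permutation of the triple index set exchanging the last two components. -/
def swap23 (I : Type*) : Equiv.Perm (I × I × I) where
  toFun p := (p.1, p.2.2, p.2.1)
  invFun p := (p.1, p.2.2, p.2.1)

lemma lift12_flipP (N : ℕ) : lift12 (flipP N) = (swap12 (Fin N)).permMatrix ℂ := by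
  ext ⟨a, b, c⟩ ⟨d, e, f⟩
  simp only [lift12, flipP, swap12, Equiv.Perm.permMatrix, PEquiv.toMatrix_apply,
    Equiv.toPEquiv_apply, Equiv.coe_fn_mk, Option.mem_some_iff, Prod.mk.injEq]
  grind

lemma lift23_flipP (N : ℕ) : lift23 (flipP N) = (swap23 (Fin N)).permMatrix ℂ := by
  ext ⟨a, b, c⟩ ⟨d, e, f⟩
  simp only [lift23, flipP, swap23, Equiv.Perm.permMatrix, PEquiv.toMatrix_apply,
    Equiv.toPEquiv_apply, Equiv.coe_fn_mk, Option.mem_some_iff, Prod.mk.injEq]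
  grind

lemma lift12_smul_add_smul_one {I : Type*} [DecidableEq I] (M : Matrix (I × I) (I × I) ℂ)
    (r u c : ℂ) : lift12 (r • (u • M + c • 1)) = r • (u • lift12 M + c • 1) := by
  ext ⟨a, b, c⟩ ⟨d, e, f⟩
  simp only [lift12, Matrix.smul_apply, Matrix.add_apply, Matrix.one_apply, smul_eq_mul,
    Prod.mk.injEq]
  grind

lemma lift23_smul_add_smul_one {I : Type*} [DecidableEq I] (M : Matrix (I × I) (I × I) ℂ)
    (r u c : ℂ) : lift23 (r • (u • M + c • 1)) = r • (u • lift23 M + c • 1) := by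
  ext ⟨a, b, c⟩ ⟨d, e, f⟩
  simp only [lift23, Matrix.smul_apply, Matrix.add_apply, Matrix.one_apply, smul_eq_mul,
    Prod.mk.injEq]
  grind

/-- Baxterization: two involutions satisfying the braid relation satisfy the spectral
Yang–Baxter equation. -/
lemma yangBaxter_of_braid {R A : Type*} [CommRing R] [Ring A] [Algebra R A] {a b : A}
    (ha : a * a = 1) (hb : b * b = 1) (hab : a * b * a = b * a * b) (u w c : R) :
    (u • a + c • 1) * ((u + w) • b + c • 1) * (w • a + c • 1)
      = (w • b + c • 1) * ((u + w) • a + c • 1) * (u • b + c • 1) := by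
  simp only [add_mul, mul_add, smul_mul_assoc, mul_smul_comm, one_mul, mul_one, ha, hb, hab]
  module

/-- The `gl(N)`-invariant exchange matrix satisfies the braid-form quantum
Yang–Baxter equation. -/
theorem stmt14 (N : ℕ) (hN : 1 ≤ N) (g : ℝ) (hg : g ≠ 0) (s : ℝ → ℝ) :
    ∀ χ₁ χ₂ χ₃ : ℝ,
      lift12 (glS N g s χ₁ χ₂) * lift23 (glS N g s χ₁ χ₃) * lift12 (glS N g s χ₂ χ₃)
        = lift23 (glS N g s χ₂ χ₃) * lift12 (glS N g s χ₁ χ₃)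
            * lift23 (glS N g s χ₁ χ₂) := by
  intro χ₁ χ₂ χ₃
  have h12 : lift12 (flipP N) * lift12 (flipP N) = 1 := by
    rw [lift12_flipP, ← Matrix.permMatrix_mul, ← Matrix.permMatrix_one]
    rfl
  have h23 : lift23 (flipP N) * lift23 (flipP N) = 1 := by
    rw [lift23_flipP, ← Matrix.permMatrix_mul, ← Matrix.permMatrix_one]
    rfl
  have hbraid : lift12 (flipP N) * lift23 (flipP N) * lift12 (flipP N)
      = lift23 (flipP N) * lift12 (flipP N) * lift23 (flipP N) := by
    simp only [lift12_flipP, lift23_flipP, ← Matrix.permMatrix_mul]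
    rfl
  have key := yangBaxter_of_braid h12 h23 hbraid ((s χ₁ : ℂ) - s χ₂) ((s χ₂ : ℂ) - s χ₃)
    (Complex.I * g)
  rw [sub_add_sub_cancel] at key
  simp only [glS, lift12_smul_add_smul_one, lift23_smul_add_smul_one, smul_mul_assoc,
    mul_smul_comm, key, smul_smul]
  congr 1
  ring
end

section
/- Let g ≠ 0 be real, s : ℝ → ℝ an even function, and let S₁₂ be the gl(N)-invariant exchange matrix S₁₂(χ₁,χ₂) := ((s(χ₁) − s(χ₂))·P + i·g·1)/(s(χ₁) − s(χ₂) + i·g). Let p, q⁺, q⁻ : ℝ → ℝ be arbitrary real-valued functions and define R^±(χ) := cos(p(±χ))·exp(i·q^±(±χ))·1 and T^±(χ) := ±sin(p(±χ))·exp(i·q^±(±χ))·1 (scalar multiples of the N×N identity). Then: (i) the unitarity conditions (1u)–(4u) hold for every χ > 0: R⁺(χ)R⁺(χ)† + T⁺(χ)T⁺(χ)† = 1, R⁻(−χ)R⁻(−χ)† + T⁻(−χ)T⁻(−χ)† = 1, R⁺(χ)†R⁺(χ) + T⁻(−χ)†T⁻(−χ) = 1, R⁻(−χ)†R⁻(−χ)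 + T⁺(χ)†T⁺(χ) = 1, R⁺(χ)T⁻(−χ)† + T⁺(χ)R⁻(−χ)† = 0, R⁻(−χ)T⁺(χ)† + T⁻(−χ)R⁺(χ)† = 0, R⁺(χ)†T⁺(χ) + T⁻(−χ)†R⁻(−χ) = 0, R⁻(−χ)†T⁻(−χ) + T⁺(χ)†R⁺(χ) = 0; (ii) both R⁺ and R⁻ satisfy (SR): S₁₂(χ₁,χ₂)R^±₂(χ₁) = R^±₁(χ₁)S₁₂(−χ₁,χ₂) for all χ₁,χ₂; and (iii) the pure transmission conditions hold for all χ₁,χ₂: (TST) T⁺₁(χ₁)S₁₂(χ₁,χ₂)T⁻₁(χ₂) = T⁻₂(χ₂)S₁₂(χ₁,χ₂)T⁺₂(χ₁), (STT−) S₁₂(χ₁,χ₂)T⁻₁(χ₂)T⁻₂(χ₁) = T⁻₁(χ₁)T⁻₂(χ₂)S₁₂(χ₁,χ₂), and (STT+) S₁₂(χ₁,χ₂)T⁺₁(χ₂)T⁺₂(χ₁) = T⁺₁(χ₁)T⁺₂(χ₂)S₁₂(χ₁,χ₂). -/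
open Matrix Kronecker

theorem emb1_smul_one {N : ℕ} (c : ℂ) :
    emb1 (c • (1 : Matrix (Fin N) (Fin N) ℂ)) = c • 1 := by
  simp [emb1, Matrix.smul_kronecker]

theorem emb2_smul_one {N : ℕ} (c : ℂ) :
    emb2 (c • (1 : Matrix (Fin N) (Fin N) ℂ)) = c • 1 := by
  simp [emb2, Matrix.kronecker_smul]

theorem glS_neg_left (N : ℕ) (g : ℝ) (s : ℝ → ℝ) (hs : ∀ χ : ℝ, s (-χ) = s χ) (χ₁ χ₂ : ℝ) :
    glS N g s (-χ₁) χ₂ = glS N g s χ₁ χ₂ := by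
  simp only [glS, hs]

theorem exp_I_mul_mul_star (q : ℝ) :
    Complex.exp (Complex.I * q) * star (Complex.exp (Complex.I * q)) = 1 := by
  rw [Complex.star_def, ← Complex.exp_conj, ← Complex.exp_add]
  simp

/-- Unitarity of the scalar scattering matrix, in the form used for multiples of the identity. -/
theorem scalar_unitarity {N : ℕ} (c t u v : ℂ) (hc : star c = c) (ht : star t = t)
    (hct : c ^ 2 + t ^ 2 = 1) (hu : u * star u = 1) (hv : v * star v = 1)
    (A B C D : Matrix (Fin N) (Fin N) ℂ) (hA : A = (c * u) • 1) (hB : B = (c * v) • 1)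
    (hC : C = (t * u) • 1) (hD : D = (-t * v) • 1) :
    A * Aᴴ + C * Cᴴ = 1 ∧ B * Bᴴ + D * Dᴴ = 1 ∧
    Aᴴ * A + Dᴴ * D = 1 ∧ Bᴴ * B + Cᴴ * C = 1 ∧
    A * Dᴴ + C * Bᴴ = 0 ∧ B * Cᴴ + D * Aᴴ = 0 ∧
    Aᴴ * C + Dᴴ * B = 0 ∧ Bᴴ * D + Cᴴ * A = 0 := by
  subst hA hB hC hD
  have one_of {z : ℂ} (hz : z = 1) : z • (1 : Matrix (Fin N) (Fin N) ℂ) = 1 := by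
    rw [hz, one_smul]
  have zero_of {z : ℂ} (hz : z = 0) : z • (1 : Matrix (Fin N) (Fin N) ℂ) = 0 := by
    rw [hz, zero_smul]
  simp only [conjTranspose_smul, conjTranspose_one, Matrix.mul_smul,
    Matrix.mul_one, smul_smul, ← add_smul, star_mul', star_neg, hc, ht]
  refine ⟨one_of ?_, one_of ?_, one_of ?_, one_of ?_, zero_of ?_, zero_of ?_, zero_of ?_,
    zero_of ?_⟩
  · linear_combination (c ^ 2 + t ^ 2) * hu + hct
  · linear_combination (c ^ 2 + t ^ 2) * hv + hct
  · linear_combination c ^ 2 * hu + t ^ 2 * hv + hct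
  · linear_combination c ^ 2 * hv + t ^ 2 * hu + hct
  · ring
  · ring
  · linear_combination c * t * hu - c * t * hv
  · linear_combination c * t * hu - c * t * hv

/-- The reflection/transmission matrices (Rgln), (Tgln) for the `gl(N)`-invariant
`S`-matrix satisfy the unitarity conditions (1u)–(4u), condition (SR), and the pure
transmission conditions (TST), (STT−), (STT+). -/
theorem stmt15 (N : ℕ) (hN : 1 ≤ N) (g : ℝ) (hg : g ≠ 0) (s : ℝ → ℝ)
    (hs : ∀ χ : ℝ, s (-χ) = s χ)
    (p qp qm : ℝ → ℝ)
    (Rp Rm Tp Tm : ℝ → Matrix (Fin N) (Fin N) ℂ)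
    (hRp : ∀ χ : ℝ, Rp χ
      = ((Real.cos (p χ) : ℂ) * Complex.exp (Complex.I * (qp χ))) • 1)
    (hRm : ∀ χ : ℝ, Rm χ
      = ((Real.cos (p (-χ)) : ℂ) * Complex.exp (Complex.I * (qm (-χ)))) • 1)
    (hTp : ∀ χ : ℝ, Tp χ
      = ((Real.sin (p χ) : ℂ) * Complex.exp (Complex.I * (qp χ))) • 1)
    (hTm : ∀ χ : ℝ, Tm χ
      = (-(Real.sin (p (-χ)) : ℂ) * Complex.exp (Complex.I * (qm (-χ)))) • 1) :
    (∀ χ : ℝ, 0 < χ →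
      Rp χ * (Rp χ)ᴴ + Tp χ * (Tp χ)ᴴ = 1 ∧
      Rm (-χ) * (Rm (-χ))ᴴ + Tm (-χ) * (Tm (-χ))ᴴ = 1 ∧
      (Rp χ)ᴴ * Rp χ + (Tm (-χ))ᴴ * Tm (-χ) = 1 ∧
      (Rm (-χ))ᴴ * Rm (-χ) + (Tp χ)ᴴ * Tp χ = 1 ∧
      Rp χ * (Tm (-χ))ᴴ + Tp χ * (Rm (-χ))ᴴ = 0 ∧
      Rm (-χ) * (Tp χ)ᴴ + Tm (-χ) * (Rp χ)ᴴ = 0 ∧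
      (Rp χ)ᴴ * Tp χ + (Tm (-χ))ᴴ * Rm (-χ) = 0 ∧
      (Rm (-χ))ᴴ * Tm (-χ) + (Tp χ)ᴴ * Rp χ = 0) ∧
    (∀ χ₁ χ₂ : ℝ,
      glS N g s χ₁ χ₂ * emb2 (Rp χ₁) = emb1 (Rp χ₁) * glS N g s (-χ₁) χ₂ ∧
      glS N g s χ₁ χ₂ * emb2 (Rm χ₁) = emb1 (Rm χ₁) * glS N g s (-χ₁) χ₂) ∧
    (∀ χ₁ χ₂ : ℝ,
      emb1 (Tp χ₁) * glS N g s χ₁ χ₂ * emb1 (Tm χ₂)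
        = emb2 (Tm χ₂) * glS N g s χ₁ χ₂ * emb2 (Tp χ₁) ∧
      glS N g s χ₁ χ₂ * emb1 (Tm χ₂) * emb2 (Tm χ₁)
        = emb1 (Tm χ₁) * emb2 (Tm χ₂) * glS N g s χ₁ χ₂ ∧
      glS N g s χ₁ χ₂ * emb1 (Tp χ₂) * emb2 (Tp χ₁)
        = emb1 (Tp χ₁) * emb2 (Tp χ₂) * glS N g s χ₁ χ₂) := by
  refine ⟨fun χ _ => ?_, fun χ₁ χ₂ => ?_, fun χ₁ χ₂ => ?_⟩
  · have hct : (Real.cos (p χ) : ℂ) ^ 2 + (Real.sin (p χ) : ℂ) ^ 2 = 1 := by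
      exact_mod_cast Real.cos_sq_add_sin_sq (p χ)
    exact scalar_unitarity _ _ _ _ (Complex.conj_ofReal _) (Complex.conj_ofReal _) hct
      (exp_I_mul_mul_star (qp χ)) (exp_I_mul_mul_star (qm χ)) _ _ _ _ (hRp χ)
      (by rw [hRm, neg_neg]) (hTp χ) (by rw [hTm, neg_neg])
  · rw [hRp, hRm, glS_neg_left N g s hs]
    simp only [emb1_smul_one, emb2_smul_one, Matrix.smul_mul, Matrix.mul_smul, Matrix.mul_one,
      Matrix.one_mul, and_self]
  · simp only [hTp, hTm, emb1_smul_one, emb2_smul_one, Matrix.smul_mul, Matrix.mul_smul,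
      Matrix.mul_one, Matrix.one_mul, smul_smul]
    refine ⟨?_, ?_, ?_⟩ <;> congr 1 <;> ring
end
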